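/- arXiv:1003.3997 — 7 statements merged into one kernel-verified Lean document; each statement's English description precedes it below -/
import Mathlib

section
/- Let R be a Noetherian local integral domain and let A be an m×n matrix with entries in R such that for every k ≥ 1 the ideal of R generated by all k×k minors of A is a principal ideal. Then the R-submodule of R^m generated by the columns of A (i.e., the image of the R-linear map R^n → R^m given by A) is a free R-module. -/
theorem aux_exists_gen {R : Type*} [CommRing R] [IsDomain R] [IsLocalRing R] (S : Set R)
    (h : (Ideal.span S).IsPrincipal) (hne : ∃ x ∈ S, x ≠ 0) :
    ∃ x ∈ S, x ≠ 0 ∧ ∀ y ∈ S, x ∣ y := by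
  obtain ⟨g, hg⟩ := h
  have hg : Ideal.span S = Ideal.span {g} := hg
  have hdvd : ∀ y ∈ S, g ∣ y := fun y hy =>
    Ideal.mem_span_singleton.1 (hg ▸ Ideal.subset_span hy)
  have hg0 : g ≠ 0 := by
    rintro rfl
    obtain ⟨x, hx, hx0⟩ := hne
    exact hx0 (zero_dvd_iff.1 (hdvd x hx))
  by_cases hu : ∃ a : R, IsUnit a ∧ g * a ∈ S
  · obtain ⟨a, ha, has⟩ := hu
    refine ⟨g * a, has, mul_ne_zero hg0 ha.ne_zero, fun y hy => ?_⟩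
    exact (ha.mul_right_dvd).2 (hdvd y hy)
  · exfalso
    push Not at hu
    have hle : Ideal.span S ≤ Ideal.span {g} * IsLocalRing.maximalIdeal R := by
      rw [Ideal.span_le]
      intro y hy
      obtain ⟨a, rfl⟩ := hdvd y hy
      refine Ideal.mem_span_singleton_mul.2 ⟨a, ?_, rfl⟩
      rw [IsLocalRing.mem_maximalIdeal]
      exact fun hua => hu a hua hy
    have hgm : g ∈ Ideal.span {g} * IsLocalRing.maximalIdeal R :=
      hle (hg ▸ Ideal.mem_span_singleton_self g)
    obtain ⟨a, ha, hga⟩ := Ideal.mem_span_singleton_mul.1 hgm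
    have : a = 1 := mul_left_cancel₀ hg0 (by simpa using hga)
    subst this
    exact (IsLocalRing.mem_maximalIdeal _).1 ha isUnit_one

theorem aux_cramer {R : Type*} [CommRing R] [IsDomain R] {k : ℕ}
    (M : Matrix (Fin k) (Fin k) R) (b a : Fin k → R) (x : R) (hd : M.det ≠ 0)
    (hN : (Matrix.fromBlocks M (Matrix.replicateCol Unit b) (Matrix.replicateRow Unit a)
      (Matrix.of fun _ _ => x)).det = 0) :
    M.det * x = a ⬝ᵥ (M.cramer b) := by
  have key : Matrix.fromBlocks M (Matrix.replicateCol Unit b) (Matrix.replicateRow Unit a)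
      (Matrix.of fun _ _ => x) * Matrix.fromBlocks M.adjugate (Matrix.replicateCol Unit (-(M.cramer b)))
        0 (Matrix.of fun _ _ => M.det) =
      Matrix.fromBlocks (M.det • (1 : Matrix (Fin k) (Fin k) R)) 0
        (Matrix.replicateRow Unit a * M.adjugate)
        (Matrix.of fun _ _ => M.det * x - a ⬝ᵥ (M.cramer b)) := by
    rw [Matrix.fromBlocks_multiply]
    congr 1
    · simp [Matrix.mul_adjugate]
    · ext i j
      have := congrFun (Matrix.mulVec_cramer M b) i
      simp only [Matrix.mulVec, dotProduct] at this
      simp [Matrix.mul_apply, this, mul_comm]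
    · simp
    · ext i j
      simp [Matrix.mul_apply, dotProduct]
      ring
  have h2 := congrArg Matrix.det key
  rw [Matrix.det_mul, hN, zero_mul, Matrix.det_fromBlocks_zero₁₂] at h2
  simp [Matrix.det_unique, hd] at h2
  exact sub_eq_zero.1 h2

theorem image_free_of_principal_minors
    (R : Type*) [CommRing R] [IsDomain R] [IsNoetherianRing R] [IsLocalRing R]
    (m n : ℕ) (A : Matrix (Fin m) (Fin n) R)
    (hmin : ∀ k : ℕ, 1 ≤ k →
      (Ideal.span {x : R | ∃ (r : Fin k → Fin m) (c : Fin k → Fin n),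
          Function.Injective r ∧ Function.Injective c ∧
          x = (A.submatrix r c).det}).IsPrincipal) :
    Module.Free R (LinearMap.range A.mulVecLin) := by
  classical
  let P : ℕ → Prop := fun k => ∃ (r : Fin k → Fin m) (c : Fin k → Fin n),
    (A.submatrix r c).det ≠ 0
  have inj : ∀ (k : ℕ) (r : Fin k → Fin m) (c : Fin k → Fin n),
      (A.submatrix r c).det ≠ 0 → Function.Injective r ∧ Function.Injective c := by
    intro k r c h
    constructor
    · intro i j hij
      by_contra hne
      exact h (Matrix.det_zero_of_row_eq hne (by ext; simp [hij]))
    · intro i j hij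
      by_contra hne
      exact h (Matrix.det_zero_of_column_eq hne (by simp [hij]))
  have P0 : P 0 := ⟨Fin.elim0, Fin.elim0, by simp⟩
  have Pb : ∀ k, P k → k ≤ m := by
    rintro k ⟨r, c, h⟩
    simpa using Fintype.card_le_of_injective r (inj k r c h).1
  obtain ⟨k, hk, hk1⟩ : ∃ k, P k ∧ ¬ P (k + 1) := by
    by_contra! hcon
    have : ∀ k, P k := fun k => Nat.rec P0 (fun k h => hcon k h) k
    have := Pb _ (this (m + 1))
    omega
  obtain ⟨r, c, hd, hdiv⟩ : ∃ (r : Fin k → Fin m) (c : Fin k → Fin n),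
      (A.submatrix r c).det ≠ 0 ∧ ∀ (r' : Fin k → Fin m) (c' : Fin k → Fin n),
        (A.submatrix r c).det ∣ (A.submatrix r' c').det := by
    obtain ⟨r₀, c₀, h₀⟩ := hk
    rcases Nat.eq_zero_or_pos k with rfl | hpos
    · exact ⟨r₀, c₀, h₀, fun _ _ => by simp⟩
    · obtain ⟨x, ⟨r, c, -, -, rfl⟩, hx0, hx⟩ := aux_exists_gen _ (hmin k hpos)
        ⟨_, ⟨r₀, c₀, (inj _ _ _ h₀).1, (inj _ _ _ h₀).2, rfl⟩, h₀⟩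
      refine ⟨r, c, hx0, fun r' c' => ?_⟩
      by_cases h' : (A.submatrix r' c').det = 0
      · rw [h']; exact dvd_zero _
      · exact hx _ ⟨r', c', (inj _ _ _ h').1, (inj _ _ _ h').2, rfl⟩
  have hcol : ∀ j, ∃ w : Fin k → R, ∀ i, A i j = ∑ l, w l * A i (c l) := by
    intro j
    have hw : ∀ l, ∃ t, (A.submatrix r c).cramer (fun p => A (r p) j) l
        = (A.submatrix r c).det * t := by
      intro l
      have := hdiv r (Function.update c l j)
      convert this using 1
      rw [Matrix.cramer_apply]
      have e : (A.submatrix r c).updateCol l (fun p => A (r p) j)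
          = A.submatrix r (Function.update c l j) := by
        ext p q
        by_cases hq : q = l
        · subst hq; simp
        · simp [hq]
      rw [e]; rfl
    choose w hw using hw
    refine ⟨w, fun i => ?_⟩
    have h := aux_cramer (A.submatrix r c) (fun p => A (r p) j) (fun q => A i (c q)) (A i j) hd ?_
    · apply mul_left_cancel₀ hd
      rw [h, dotProduct, Finset.mul_sum]
      refine Finset.sum_congr rfl fun l _ => ?_
      rw [hw]; ring
    · by_contra hne
      apply hk1
      let e : Fin (k + 1) ≃ Fin k ⊕ Unit := 
        (Fintype.equivFinOfCardEq (by simp)).symm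
      refine ⟨Sum.elim r (fun _ => i) ∘ e, Sum.elim c (fun _ => j) ∘ e, ?_⟩
      rw [← Matrix.submatrix_submatrix, Matrix.det_submatrix_equiv_self]
      convert hne using 2
      ext p q
      rcases p with p | p <;> rcases q with q | q <;> simp
  have hli : LinearIndependent R (fun l : Fin k => A.col (c l)) := by
    have h1 := Matrix.linearIndependent_cols_of_det_ne_zero hd
    exact LinearIndependent.of_comp (LinearMap.funLeft R R r) h1
  have hspan : LinearMap.range A.mulVecLin
      = Submodule.span R (Set.range (fun l : Fin k => A.col (c l))) := by
    rw [Matrix.range_mulVecLin]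
    apply le_antisymm
    · rw [Submodule.span_le]
      rintro _ ⟨j, rfl⟩
      obtain ⟨w, hw⟩ := hcol j
      have : A.col j = ∑ l, w l • A.col (c l) := by
        ext i; simp [hw i, Finset.sum_apply]
      rw [SetLike.mem_coe, this]
      exact Submodule.sum_mem _ fun l _ => Submodule.smul_mem _ _ (Submodule.subset_span ⟨l, rfl⟩)
    · apply Submodule.span_mono
      rintro _ ⟨l, rfl⟩
      exact ⟨c l, rfl⟩
  rw [hspan]
  exact Module.Free.of_basis (Module.Basis.span hli)
end

section
/- Let A be a commutative ℚ-algebra, let n ≥ 0 and k ≥ 0 be integers, and let w : Fin (n+1) → A. For each natural number d define P(d) := Σ_{α} (Σ_{i=0}^{n} α_i • w_i)^k, where the outer sum runs over all functions α : Fin (n+1) → ℕ with α_0 + ⋯ + α_n = d, and α_i • w_i denotes the ℕ-scalar multiple. Then there exists a polynomial p ∈ A[X] of degree at most k + n such that P(d) = p evaluated at the image of d in A, for all natural numbers d. -/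
open Polynomial in
/-- polynomial function of degree at most m -/
def PolyFn (A : Type*) [CommRing A] (m : ℕ) (f : ℕ → A) : Prop :=
  ∃ p : Polynomial A, p.degree ≤ (m : ℕ) ∧ ∀ d : ℕ, f d = p.eval (d : A)

open Polynomial in
theorem PolyFn.sum {A : Type*} [CommRing A] {m : ℕ} {ι : Type*} (s : Finset ι) (f : ι → ℕ → A)
    (h : ∀ i ∈ s, PolyFn A m (f i)) : PolyFn A m (fun d => ∑ i ∈ s, f i d) := by
  classical
  choose! p hp hf using h
  refine ⟨∑ i ∈ s, p i, ?_, ?_⟩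
  · exact (Polynomial.degree_sum_le _ _).trans (Finset.sup_le hp)
  · intro d
    rw [Polynomial.eval_finsetSum]
    exact Finset.sum_congr rfl fun i hi => hf i hi d

theorem PolyFn.mul {A : Type*} [CommRing A] {m l : ℕ} {f g : ℕ → A}
    (hf : PolyFn A m f) (hg : PolyFn A l g) : PolyFn A (m + l) (fun d => f d * g d) := by
  obtain ⟨p, hp, hf⟩ := hf
  obtain ⟨q, hq, hg⟩ := hg
  refine ⟨p * q, ?_, fun d => by simp [hf, hg]⟩
  push_cast
  exact (Polynomial.degree_mul_le _ _).trans (add_le_add hp hq)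

theorem PolyFn.mono {A : Type*} [CommRing A] {m l : ℕ} {f : ℕ → A}
    (hf : PolyFn A m f) (h : m ≤ l) : PolyFn A l f := by
  obtain ⟨p, hp, hf⟩ := hf
  exact ⟨p, hp.trans (by exact_mod_cast h), hf⟩

theorem PolyFn.const_mul_pow {A : Type*} [CommRing A] (c : A) (m : ℕ) :
    PolyFn A m (fun d => c * (d : A) ^ m) :=
  ⟨Polynomial.C c * Polynomial.X ^ m, Polynomial.degree_C_mul_X_pow_le _ _, fun d => by simp⟩

theorem PolyFn.shift {A : Type*} [CommRing A] {m : ℕ} {f : ℕ → A}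
    (hf : PolyFn A m f) : PolyFn A m (fun d => f (d + 1)) := by
  obtain ⟨p, hp, hf⟩ := hf
  refine ⟨p.comp (Polynomial.X + 1), ?_, fun d => by simp [hf]⟩
  rw [← Polynomial.natDegree_le_iff_degree_le] at hp ⊢
  refine Polynomial.natDegree_comp_le.trans ?_
  have : (Polynomial.X + 1 : Polynomial A).natDegree ≤ 1 := by
    exact (Polynomial.natDegree_add_le _ _).trans (by simp [Polynomial.natDegree_X_le])
  nlinarith

theorem PolyFn.sum_range_pow {A : Type*} [CommRing A] [Algebra ℚ A] (m : ℕ) :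
    PolyFn A (m + 1) (fun d => ∑ b ∈ Finset.range d, (b : A) ^ m) := by
  have h : (fun d : ℕ => ∑ b ∈ Finset.range d, (b : A) ^ m) = fun d : ℕ =>
      ∑ i ∈ Finset.range (m + 1),
        algebraMap ℚ A (bernoulli i * ((m + 1).choose i) / (m + 1)) * (d : A) ^ (m + 1 - i) := by
    funext d
    have := congrArg (algebraMap ℚ A) (_root_.sum_range_pow d m)
    simp only [map_sum, map_pow, map_natCast] at this
    rw [this]
    refine Finset.sum_congr rfl fun i _ => ?_
    rw [← map_natCast (algebraMap ℚ A) d, ← map_pow, ← map_mul]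
    congr 1
    ring
  rw [h]
  exact PolyFn.sum _ _ fun i _ => (PolyFn.const_mul_pow _ _).mono (by omega)

theorem PolyFn.sum_range {A : Type*} [CommRing A] [Algebra ℚ A] {m : ℕ} {f : ℕ → A}
    (hf : PolyFn A m f) : PolyFn A (m + 1) (fun d => ∑ b ∈ Finset.range (d + 1), f b) := by
  apply PolyFn.shift (f := fun d => ∑ b ∈ Finset.range d, f b)
  obtain ⟨p, hp, hf⟩ := hf
  rw [← Polynomial.natDegree_le_iff_degree_le] at hp
  have h : (fun d : ℕ => ∑ b ∈ Finset.range d, f b) = fun d : ℕ =>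
      ∑ i ∈ Finset.range (m + 1), (p.coeff i * (d : A) ^ 0) * ∑ b ∈ Finset.range d, (b : A) ^ i := by
    funext d
    simp_rw [hf, Polynomial.eval_eq_sum_range' (Nat.lt_succ_of_le hp), pow_zero, mul_one,
      Finset.mul_sum]
    exact Finset.sum_comm
  rw [h]
  refine PolyFn.sum _ _ fun i hi => ?_
  have := Finset.mem_range.1 hi
  exact ((PolyFn.const_mul_pow _ 0).mul (PolyFn.sum_range_pow i)).mono (by omega)

theorem sum_antidiagonalTuple_succ {A : Type*} [CommRing A] (n d : ℕ) (F : (Fin (n + 1) → ℕ) → A) :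
    ∑ α ∈ Finset.Nat.antidiagonalTuple (n + 1) d, F α =
      ∑ b ∈ Finset.range (d + 1), ∑ β ∈ Finset.Nat.antidiagonalTuple n b,
        F (Fin.cons (d - b) β) := by
  rw [Finset.sum_sigma']
  refine Finset.sum_bij' (fun α _ => ⟨d - α 0, Fin.tail α⟩) (fun x _ => Fin.cons (d - x.1) x.2)
    ?_ ?_ ?_ ?_ ?_
  · intro α h
    rw [Finset.Nat.mem_antidiagonalTuple, Fin.sum_univ_succ] at h
    simp only [Finset.mem_sigma, Finset.mem_range, Finset.Nat.mem_antidiagonalTuple, Fin.tail]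
    omega
  · rintro ⟨b, β⟩ h
    simp only [Finset.mem_sigma, Finset.mem_range, Finset.Nat.mem_antidiagonalTuple] at h
    simp only [Finset.Nat.mem_antidiagonalTuple, Fin.sum_univ_succ, Fin.cons_zero, Fin.cons_succ]
    omega
  · intro α h
    rw [Finset.Nat.mem_antidiagonalTuple, Fin.sum_univ_succ] at h
    have : d - (d - α 0) = α 0 := by omega
    simp [this]
  · rintro ⟨b, β⟩ h
    simp only [Finset.mem_sigma, Finset.mem_range, Finset.Nat.mem_antidiagonalTuple] at h
    have : d - (d - b) = b := by omega
    simp [this]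
  · intro α h
    rw [Finset.Nat.mem_antidiagonalTuple, Fin.sum_univ_succ] at h
    have : d - (d - α 0) = α 0 := by omega
    simp [this]

theorem polyFn_main (A : Type*) [CommRing A] [Algebra ℚ A] (n : ℕ) :
    ∀ (k : ℕ) (w : Fin (n + 1) → A), PolyFn A (k + n) (fun d =>
      ∑ α ∈ Finset.Nat.antidiagonalTuple (n + 1) d, (∑ i, α i • w i) ^ k) := by
  induction n with
  | zero =>
    intro k w
    convert PolyFn.const_mul_pow (w 0 ^ k) k using 2 with d
    · simp
    · change ∑ α ∈ Finset.Nat.antidiagonalTuple 1 d, (∑ i : Fin 1, α i • w i) ^ k = _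
      rw [Finset.Nat.antidiagonalTuple_one]
      simp [mul_pow, mul_comm]
  | succ n ih =>
    intro k w
    have h : (fun d : ℕ => ∑ α ∈ Finset.Nat.antidiagonalTuple (n + 1 + 1) d,
        (∑ i, α i • w i) ^ k) = fun d : ℕ => ∑ j ∈ Finset.range (k + 1),
        ((w 0 ^ j * (k.choose j : A)) * (d : A) ^ j) * ∑ b ∈ Finset.range (d + 1),
          ∑ β ∈ Finset.Nat.antidiagonalTuple (n + 1) b,
            (∑ i, β i • (w i.succ - w 0)) ^ (k - j) := by
      funext d
      rw [sum_antidiagonalTuple_succ]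
      simp_rw [Finset.mul_sum]
      rw [Finset.sum_comm]
      refine Finset.sum_congr rfl fun b hb => ?_
      rw [Finset.sum_comm]
      refine Finset.sum_congr rfl fun β hβ => ?_
      have hb' := Finset.mem_range.1 hb
      rw [Finset.Nat.mem_antidiagonalTuple] at hβ
      have e : ∑ i, (Fin.cons (d - b) β : Fin (n + 1 + 1) → ℕ) i • w i =
          (d : A) * w 0 + ∑ i, β i • (w i.succ - w 0) := by
        rw [Fin.sum_univ_succ]
        simp only [Fin.cons_zero, Fin.cons_succ, smul_sub, Finset.sum_sub_distrib,
          ← Finset.sum_smul, hβ]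
        simp only [nsmul_eq_mul]
        rw [Nat.cast_sub (by omega)]
        ring
      rw [e, add_pow]
      refine Finset.sum_congr rfl fun j _ => ?_
      ring
    rw [h]
    refine PolyFn.sum _ _ fun j hj => ?_
    have := Finset.mem_range.1 hj
    exact ((PolyFn.const_mul_pow _ j).mul
      (PolyFn.sum_range (ih (k - j) fun i => w i.succ - w 0))).mono (by omega)

/-- **Claim in Lemma 3.7.**  Let `A` be a commutative `ℚ`-algebra, `w : Fin (n+1) → A`
a family of weights.  The `k`-th power sum
`P(d) = ∑_{α₀+⋯+αₙ = d} (∑ i, αᵢ • wᵢ)^k` of the weights of the degree-`d` monomials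
in `n+1` variables is a polynomial function of `d` of degree at most `k + n`. -/
theorem powerSum_weights_polynomial_in_degree
    (A : Type*) [CommRing A] [Algebra ℚ A] (n k : ℕ) (w : Fin (n + 1) → A) :
    ∃ p : Polynomial A, p.degree ≤ (k + n : ℕ) ∧
      ∀ d : ℕ,
        ∑ α ∈ Finset.Nat.antidiagonalTuple (n + 1) d, (∑ i, α i • w i) ^ k
          = p.eval (d : A) := by
  exact polyFn_main A n k w
end

section
/- Let G ∈ ℂ[z_0, z_1, z_2] be a homogeneous polynomial of degree 2 whose three partial derivatives ∂G/∂z_0, ∂G/∂z_1, ∂G/∂z_2 are linearly independent over ℂ (i.e., G defines a smooth conic). Then for every integer d ≥ 0 the ℂ-linear map θ_G : S_d^3 → S_{d+1} defined by θ_G(F_0, F_1, F_2) = F_0·∂G/∂z_0 + F_1·∂G/∂z_1 + F_2·∂G/∂z_2 is surjective; in particular its rank is C(d+3, 2). -/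
open MvPolynomial

/-- The map `θ_G : (F₀,F₁,F₂) ↦ F₀·∂G/∂z₀ + F₁·∂G/∂z₁ + F₂·∂G/∂z₂`. -/
noncomputable def thetaMap (G : MvPolynomial (Fin 3) ℂ) :
    (Fin 3 → MvPolynomial (Fin 3) ℂ) →ₗ[ℂ] MvPolynomial (Fin 3) ℂ :=
  ∑ i, (LinearMap.mulRight ℂ (pderiv i G)).comp (LinearMap.proj i)

/-- The space `S_d^3` of triples of homogeneous polynomials of degree `d` in `z₀,z₁,z₂`. -/
noncomputable def SdTriples (d : ℕ) :
    Submodule ℂ (Fin 3 → MvPolynomial (Fin 3) ℂ) :=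
  Submodule.pi Set.univ fun _ => homogeneousSubmodule (Fin 3) ℂ d

theorem aux_finrank (n : ℕ) :
    Module.finrank ℂ (homogeneousSubmodule (Fin 3) ℂ n) = (n + 2).choose 2 := by
  have hs : {m : Fin 3 →₀ ℕ | m.degree = n} =
      ((Finset.univ : Finset (Fin 3)).finsuppAntidiag n : Set (Fin 3 →₀ ℕ)) := by
    ext m
    simp [Finsupp.degree_eq_sum]
  rw [homogeneousSubmodule_eq_finsupp_supported, hs,
    (AddMonoidAlgebra.supportedEquivFinsupp _).finrank_eq]
  refine (Module.finrank_finsupp_self ℂ).trans ?_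
  refine (Fintype.card_coe _).trans ?_
  rw [Finset.card_finsuppAntidiag_nat_eq_choose]
  simp only [Finset.card_univ, Fintype.card_fin]
  rw [show 3 + n - 1 = n + 2 by omega]
  exact Nat.choose_symm_of_eq_add rfl

theorem aux_theta (G : MvPolynomial (Fin 3) ℂ) (F : Fin 3 → MvPolynomial (Fin 3) ℂ) :
    thetaMap G F = ∑ i, F i * pderiv i G := by
  simp [thetaMap, LinearMap.sum_apply]

theorem aux_span (G : MvPolynomial (Fin 3) ℂ)
    (hG : G ∈ homogeneousSubmodule (Fin 3) ℂ 2)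
    (hsmooth : LinearIndependent ℂ ![pderiv 0 G, pderiv 1 G, pderiv 2 G]) :
    Submodule.span ℂ (Set.range fun i => pderiv i G) = homogeneousSubmodule (Fin 3) ℂ 1 := by
  have he : ![pderiv 0 G, pderiv 1 G, pderiv 2 G] = fun i => pderiv i G := by
    ext1 i
    fin_cases i <;> rfl
  rw [he] at hsmooth
  have : FiniteDimensional ℂ (homogeneousSubmodule (Fin 3) ℂ 1) :=
    Module.Finite.iff_fg.mpr (homogeneousSubmodule_fg _ _ 1)
  apply Submodule.eq_of_le_of_finrank_le
  · rw [Submodule.span_le]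
    rintro _ ⟨i, rfl⟩
    exact IsHomogeneous.pderiv (n := 2) hG
  · rw [aux_finrank, finrank_span_eq_card hsmooth]
    simp

theorem aux_map (G : MvPolynomial (Fin 3) ℂ)
    (hG : G ∈ homogeneousSubmodule (Fin 3) ℂ 2)
    (hsmooth : LinearIndependent ℂ ![pderiv 0 G, pderiv 1 G, pderiv 2 G]) (d : ℕ) :
    Submodule.map (thetaMap G) (SdTriples d) = homogeneousSubmodule (Fin 3) ℂ (d + 1) := by
  apply le_antisymm
  · rintro _ ⟨F, hF, rfl⟩
    rw [aux_theta]
    refine Submodule.sum_mem _ fun i _ => ?_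
    exact IsHomogeneous.mul (hF i (Set.mem_univ i)) (IsHomogeneous.pderiv (n := 2) hG)
  · rw [homogeneousSubmodule_eq_finsupp_supported, AddMonoidAlgebra.supported_eq_span_single,
      Submodule.span_le]
    rintro _ ⟨m, hm, rfl⟩
    have hm' : m.degree = d + 1 := hm
    obtain ⟨j, hj⟩ : ∃ j, m j ≠ 0 := by
      by_contra! h
      have : m = 0 := Finsupp.ext h
      simp [this] at hm'
    have hle : Finsupp.single j 1 ≤ m := by
      simpa [Finsupp.single_le_iff] using Nat.one_le_iff_ne_zero.mpr hj
    obtain ⟨m', rfl⟩ := exists_add_of_le hle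
    have hX : (X j : MvPolynomial (Fin 3) ℂ) ∈
        Submodule.span ℂ (Set.range fun i => pderiv i G) := by
      rw [aux_span G hG hsmooth]
      exact isHomogeneous_X _ j
    obtain ⟨c, hc⟩ := (Submodule.mem_span_range_iff_exists_fun ℂ).mp hX
    refine ⟨fun i => c i • monomial m' 1, ?_, ?_⟩
    · intro i _
      refine Submodule.smul_mem _ _ (isHomogeneous_monomial _ ?_)
      rw [map_add, Finsupp.degree_single] at hm'
      omega
    · rw [aux_theta]
      simp only [smul_mul_assoc, ← mul_smul_comm]
      rw [← Finset.mul_sum, hc, mul_comm, X, monomial_mul, one_mul]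
      rfl

/-- **Smooth case of the rank trichotomy for `θ` (Section 3).**  If `G` is a
homogeneous quadric in `z₀,z₁,z₂` whose partial derivatives are linearly independent
(a smooth conic), then for every `d ≥ 0` the map `θ_G : S_d^3 → S_{d+1}` is
surjective; in particular its rank is `C(d+3, 2)`. -/
theorem thetaMap_surjective_of_smooth_conic (G : MvPolynomial (Fin 3) ℂ)
    (hG : G ∈ homogeneousSubmodule (Fin 3) ℂ 2)
    (hsmooth : LinearIndependent ℂ ![pderiv 0 G, pderiv 1 G, pderiv 2 G]) (d : ℕ) :
    Submodule.map (thetaMap G) (SdTriples d) = homogeneousSubmodule (Fin 3) ℂ (d + 1) ∧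
    Module.finrank ℂ (Submodule.map (thetaMap G) (SdTriples d)) = (d + 3).choose 2 := by
  have h := aux_map G hG hsmooth d
  refine ⟨h, ?_⟩
  rw [h, aux_finrank]
end

section
/- Let L ∈ ℂ[z_0, z_1, z_2] be a nonzero homogeneous linear form and set G = L² (a double line). Then for every integer d ≥ 0 the image of the ℂ-linear map θ_G : S_d^3 → S_{d+1} defined by θ_G(F_0, F_1, F_2) = F_0·∂G/∂z_0 + F_1·∂G/∂z_1 + F_2·∂G/∂z_2 has ℂ-dimension C(d+2, 2). -/
open MvPolynomial

theorem finrank_homog (d : ℕ) :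
    Module.finrank ℂ (homogeneousSubmodule (Fin 3) ℂ d) = (d + 2).choose 2 := by
  have h1 : homogeneousSubmodule (Fin 3) ℂ d
      = restrictSupport ℂ {m : Fin 3 →₀ ℕ | m.degree = d} :=
    homogeneousSubmodule_eq_finsupp_supported (Fin 3) ℂ d
  have h2 : {m : Fin 3 →₀ ℕ | m.degree = d}
      = ((Finset.univ : Finset (Fin 3)).finsuppAntidiag d : Set (Fin 3 →₀ ℕ)) := by
    ext m
    simp [Finset.mem_finsuppAntidiag, Finsupp.degree_eq_sum]
  rw [h1, h2, Module.finrank_eq_nat_card_basis (basisRestrictSupport ℂ _)]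
  rw [Nat.card_coe_set_eq, Set.ncard_coe_finset, Finset.card_finsuppAntidiag_nat_eq_choose]
  simp only [Finset.card_univ, Fintype.card_fin]
  rw [show 3 + d - 1 = d + 2 by omega]
  rw [← Nat.choose_symm_add]

/-- **Double-line case of the rank trichotomy for `θ` (Section 3).**  If `G = L²`
for a nonzero linear form `L` in `z₀,z₁,z₂`, then for every `d ≥ 0` the image of
`θ_G : S_d^3 → S_{d+1}` has dimension `C(d+2, 2)`. -/
theorem thetaMap_rank_of_double_line (L G : MvPolynomial (Fin 3) ℂ)
    (hL : L ∈ homogeneousSubmodule (Fin 3) ℂ 1) (hL0 : L ≠ 0)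
    (hG : G = L ^ 2) (d : ℕ) :
    Module.finrank ℂ (Submodule.map (thetaMap G) (SdTriples d)) = (d + 2).choose 2 := by
  rw [homogeneousSubmodule_one_eq_span_X, Submodule.mem_span_range_iff_exists_fun] at hL
  obtain ⟨c, hc⟩ := hL
  have hd : ∀ i, pderiv i G = C (2 * c i) * L := by
    intro i
    have : pderiv i L = C (c i) := by
      rw [← hc]
      simp [map_sum, pderiv_X, Pi.single_apply, smul_eq_C_mul]
    rw [hG, Derivation.leibniz_pow, this]
    have h2 : (C 2 : MvPolynomial (Fin 3) ℂ) = 2 := map_ofNat C 2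
    simp [h2]
    ring
  have hth : ∀ F, thetaMap G F = (∑ i, C (2 * c i) * F i) * L := by
    intro F
    simp only [thetaMap, LinearMap.sum_apply, LinearMap.comp_apply, LinearMap.proj_apply,
      LinearMap.mulRight_apply, hd, Finset.sum_mul]
    exact Finset.sum_congr rfl fun i _ => by ring
  obtain ⟨j, hj⟩ : ∃ j, c j ≠ 0 := by
    by_contra! h
    exact hL0 (by rw [← hc]; simp [h])
  have himg : Submodule.map (thetaMap G) (SdTriples d)
      = Submodule.map (LinearMap.mulRight ℂ L) (homogeneousSubmodule (Fin 3) ℂ d) := by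
    ext p
    simp only [Submodule.mem_map, SdTriples, Submodule.mem_pi, LinearMap.mulRight_apply, hth]
    constructor
    · rintro ⟨F, hF, rfl⟩
      refine ⟨_, Submodule.sum_mem _ fun i _ => ?_, rfl⟩
      rw [← smul_eq_C_mul]
      exact Submodule.smul_mem _ _ (hF i trivial)
    · rintro ⟨q, hq, rfl⟩
      refine ⟨Pi.single j ((2 * c j)⁻¹ • q), fun i _ => ?_, ?_⟩
      · by_cases h : i = j
        · subst h
          rw [Pi.single_eq_same]
          exact Submodule.smul_mem _ _ hq
        · rw [Pi.single_eq_of_ne h]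
          exact Submodule.zero_mem _
      · congr 1
        rw [Finset.sum_eq_single j]
        · rw [Pi.single_eq_same, ← smul_eq_C_mul, smul_smul, mul_inv_cancel₀ (by simpa using hj),
            one_smul]
        · intro i _ h
          rw [Pi.single_eq_of_ne h, mul_zero]
        · simp
  have hinj : Function.Injective (LinearMap.mulRight ℂ L) := by
    intro a b h
    exact mul_right_cancel₀ hL0 h
  rw [himg, ← finrank_homog d]
  exact (Submodule.equivMapOfInjective _ hinj _).finrank_eq.symm
end

section
/- Let n ≥ 1, d ≥ 1, and 0 ≤ k < n be integers, and let I ⊂ ℂ[z_0,…,z_n] be the ideal generated by z_{k+1}, …, z_n. Consider the ℂ-subspace E' := {(F_0, …, F_n) ∈ S_d^{n+1} : F_i ∈ I for all i with k+1 ≤ i ≤ n} of S_d^{n+1}. Then: (a) E' has codimension (n−k)·C(k+d, d) in S_d^{n+1}; (b) (z_0·H, z_1·H, …, z_n·H) ∈ E' for every H ∈ S_{d−1}; and consequently (c) the image of E' in the quotient V_d^n := S_d^{n+1}/{(z_0H,…,z_nH) : H ∈ S_{d−1}} has codimension (n−k)·C(k+d, d) in V_d^n. -/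
open MvPolynomial

/-- Multiplication by the radial vector field: `H ↦ (z₀·H, …, zₙ·H)`. -/
noncomputable def radialMul (n : ℕ) :
    MvPolynomial (Fin (n + 1)) ℂ →ₗ[ℂ] (Fin (n + 1) → MvPolynomial (Fin (n + 1)) ℂ) :=
  LinearMap.pi fun i => LinearMap.mulLeft ℂ (X i)

/-- The space `S_d^{n+1}` of `(n+1)`-tuples of homogeneous polynomials of degree `d`. -/
noncomputable def Sdtuples (n d : ℕ) :
    Submodule ℂ (Fin (n + 1) → MvPolynomial (Fin (n + 1)) ℂ) :=
  Submodule.pi Set.univ fun _ => homogeneousSubmodule (Fin (n + 1)) ℂ d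

/-- The ideal `I = (z_{k+1}, …, z_n)` of the coordinate `k`-plane `W`. -/
noncomputable def coordPlaneIdeal (n k : ℕ) : Ideal (MvPolynomial (Fin (n + 1)) ℂ) :=
  Ideal.span (X '' {j : Fin (n + 1) | k < (j : ℕ)})

/-- The subspace `E' = {(F₀,…,Fₙ) ∈ S_d^{n+1} : Fᵢ ∈ I for k+1 ≤ i ≤ n}` of tuples
representing vector fields leaving the coordinate `k`-plane invariant. -/
noncomputable def Eprime (n d k : ℕ) :
    Submodule ℂ (Fin (n + 1) → MvPolynomial (Fin (n + 1)) ℂ) :=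
  Submodule.pi Set.univ fun i =>
    homogeneousSubmodule (Fin (n + 1)) ℂ d ⊓
      (if k < (i : ℕ) then (coordPlaneIdeal n k).restrictScalars ℂ else ⊤)

/-- The submodule of `S_d^{n+1}` of multiples `(z₀H, …, zₙH)` of the radial field. -/
noncomputable def radSub (n d : ℕ) : Submodule ℂ ↥(Sdtuples n d) :=
  Submodule.comap (Sdtuples n d).subtype
    (Submodule.map (radialMul n) (homogeneousSubmodule (Fin (n + 1)) ℂ (d - 1)))

def lowSet (n k : ℕ) : Finset (Fin (n + 1)) := Finset.univ.filter fun j => (j : ℕ) ≤ k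

def highSet (n k : ℕ) : Finset (Fin (n + 1)) := Finset.univ.filter fun j => k < (j : ℕ)

lemma card_lowSet (n k : ℕ) (hk : k < n) : (lowSet n k).card = k + 1 := by
  have : lowSet n k = Finset.Iic (⟨k, by omega⟩ : Fin (n + 1)) := by
    ext j; simp [lowSet, Fin.le_def]
  rw [this, Fin.card_Iic]

lemma card_highSet (n k : ℕ) (hk : k < n) : (highSet n k).card = n - k := by
  have : highSet n k = Finset.Ioi (⟨k, by omega⟩ : Fin (n + 1)) := by
    ext j; simp [highSet, Fin.lt_def]
  rw [this, Fin.card_Ioi]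
  simp

noncomputable def coeffMap (n d k : ℕ) :
    ↥(Sdtuples n d) →ₗ[ℂ] (highSet n k × (lowSet n k).finsuppAntidiag d → ℂ) :=
  LinearMap.pi fun p =>
    (lcoeff ℂ (p.2 : Fin (n + 1) →₀ ℕ)) ∘ₗ (LinearMap.proj (p.1 : Fin (n + 1))) ∘ₗ
      (Sdtuples n d).subtype

lemma coeffMap_apply (n d k : ℕ) (F : ↥(Sdtuples n d)) (p) :
    coeffMap n d k F p = coeff (p.2 : Fin (n + 1) →₀ ℕ) (F.1 p.1) := rfl

lemma degree_of_mem {n d k : ℕ} {m : Fin (n + 1) →₀ ℕ}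
    (hm : m ∈ (lowSet n k).finsuppAntidiag d) : m.degree = d := by
  rw [Finset.mem_finsuppAntidiag] at hm
  rw [← hm.1, Finsupp.degree_apply]
  exact Finset.sum_subset hm.2 (by simp)

lemma coeffMap_surjective (n d k : ℕ) : Function.Surjective (coeffMap n d k) := by
  classical
  intro g
  let F : Fin (n + 1) → MvPolynomial (Fin (n + 1)) ℂ := fun i =>
    if h : i ∈ highSet n k then
      ∑ m : (lowSet n k).finsuppAntidiag d, monomial (m : Fin (n + 1) →₀ ℕ) (g (⟨i, h⟩, m))
    else 0
  have hF : F ∈ Sdtuples n d := by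
    intro i _
    simp only [F]
    split_ifs with h
    · refine Submodule.sum_mem _ fun m _ => ?_
      exact isHomogeneous_monomial _ (degree_of_mem m.2)
    · exact Submodule.zero_mem _
  refine ⟨⟨F, hF⟩, ?_⟩
  funext p
  obtain ⟨i, m⟩ := p
  rw [coeffMap_apply]
  simp only [F, dif_pos i.2, coeff_sum, coeff_monomial]
  rw [Finset.sum_eq_single m]
  · simp
  · intro b _ hb
    rw [if_neg (fun h => hb (Subtype.ext h))]
  · simp

lemma ker_coeffMap (n d k : ℕ) :
    LinearMap.ker (coeffMap n d k) = Submodule.comap (Sdtuples n d).subtype (Eprime n d k) := by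
  ext F
  have hF : ∀ i, (F.1 i).IsHomogeneous d := fun i => F.2 i trivial
  rw [LinearMap.mem_ker, Submodule.mem_comap]
  constructor
  · intro h i _
    refine ⟨hF i, ?_⟩
    split_ifs with hi
    · change F.1 i ∈ coordPlaneIdeal n k
      rw [coordPlaneIdeal, mem_ideal_span_X_image]
      intro m hm
      by_contra! hc
      have hdeg : m.degree = d := by
        have := hF i (mem_support_iff.1 hm)
        rwa [Finsupp.degree_eq_weight_one]
      have hsub : m.support ⊆ lowSet n k := by
        intro j hj
        simp only [lowSet, Finset.mem_filter, Finset.mem_univ, true_and]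
        by_contra hjk
        exact (Finsupp.mem_support_iff.1 hj) (hc j (not_le.1 hjk))
      have hmem : m ∈ (lowSet n k).finsuppAntidiag d := by
        rw [Finset.mem_finsuppAntidiag]
        refine ⟨?_, hsub⟩
        rw [← hdeg, Finsupp.degree_apply]
        exact (Finset.sum_subset hsub (by simp)).symm
      have := congrFun h (⟨i, by simp [highSet, hi]⟩, ⟨m, hmem⟩)
      exact (mem_support_iff.1 hm) this
    · trivial
  · intro h
    funext p
    obtain ⟨⟨i, hi⟩, ⟨m, hm⟩⟩ := p
    have hi' : k < (i : ℕ) := by simpa [highSet] using hi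
    have h2 := (h i trivial).2
    rw [if_pos hi'] at h2
    change F.1 i ∈ coordPlaneIdeal n k at h2
    rw [coordPlaneIdeal, mem_ideal_span_X_image] at h2
    change coeff m (F.1 i) = 0
    by_contra hc
    obtain ⟨j, hj, hj0⟩ := h2 m (mem_support_iff.2 hc)
    have := (Finset.mem_finsuppAntidiag.1 hm).2 (Finsupp.mem_support_iff.2 hj0)
    simp only [lowSet, Finset.mem_filter, Finset.mem_univ, true_and] at this
    exact absurd hj (not_lt.2 this)

/-- **Fiberwise content of Proposition 2.2.**  For `n ≥ 1`, `d ≥ 1`, `0 ≤ k < n`: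
(a) `E'` has codimension `(n−k)·C(k+d, d)` in `S_d^{n+1}`;
(b) every radial multiple `(z₀H, …, zₙH)` with `H ∈ S_{d−1}` lies in `E'`;
(c) the image of `E'` in `V_d^n = S_d^{n+1}/{radial multiples}` has codimension
`(n−k)·C(k+d, d)` in `V_d^n`. -/
theorem invariant_plane_codimension (n d k : ℕ) (hn : 1 ≤ n) (hd : 1 ≤ d) (hk : k < n) :
    Module.finrank ℂ
        (↥(Sdtuples n d) ⧸ Submodule.comap (Sdtuples n d).subtype (Eprime n d k))
      = (n - k) * (k + d).choose d ∧
    (∀ H ∈ homogeneousSubmodule (Fin (n + 1)) ℂ (d - 1), radialMul n H ∈ Eprime n d k) ∧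
    Module.finrank ℂ
        ((↥(Sdtuples n d) ⧸ radSub n d) ⧸
          Submodule.map (radSub n d).mkQ
            (Submodule.comap (Sdtuples n d).subtype (Eprime n d k)))
      = (n - k) * (k + d).choose d := by
  have ha : Module.finrank ℂ
        (↥(Sdtuples n d) ⧸ Submodule.comap (Sdtuples n d).subtype (Eprime n d k))
      = (n - k) * (k + d).choose d := by
    rw [← ker_coeffMap,
      ((coeffMap n d k).quotKerEquivOfSurjective (coeffMap_surjective n d k)).finrank_eq,
      Module.finrank_fintype_fun_eq_card, Fintype.card_prod, Fintype.card_coe, Fintype.card_coe,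
      card_highSet n k hk, Finset.card_finsuppAntidiag_nat_eq_choose, card_lowSet n k hk]
    congr 2
    omega
  have hb : ∀ H ∈ homogeneousSubmodule (Fin (n + 1)) ℂ (d - 1),
      radialMul n H ∈ Eprime n d k := by
    intro H hH i _
    change X i * H ∈ _
    refine ⟨?_, ?_⟩
    · have h := (isHomogeneous_X ℂ i).mul hH
      rwa [show 1 + (d - 1) = d by omega] at h
    · split_ifs with hi
      · exact Ideal.mul_mem_right _ _ (Ideal.subset_span ⟨i, hi, rfl⟩)
      · trivial
  refine ⟨ha, hb, ?_⟩
  have hle : radSub n d ≤ Submodule.comap (Sdtuples n d).subtype (Eprime n d k) := by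
    refine Submodule.comap_mono ?_
    rintro _ ⟨H, hH, rfl⟩
    exact hb H hH
  rw [(Submodule.quotientQuotientEquivQuotient _ _ hle).finrank_eq, ha]
end

section
/- Let R = ℂ[t, s] be the polynomial ring in two variables, let d ≥ 0 be an integer, and let M_e denote the set of monomials of degree e in z_0, z_1, z_2, so that the free R-modules with bases M_d × {0,1,2} and M_{d+1} respectively are the source and target of the R-linear map θ(F_0, F_1, F_2) = 2z_0·F_0 + 2t·z_1·F_1 + 2ts·z_2·F_2 on homogeneous polynomials of degree d over R. Let A be the matrix of θ with respect to these monomial bases, and for i ≥ 1 let J_i ⊆ R be the ideal generated by all i×i minors of A. Then, writing n(d) = C(d+2, 2): J_i = (1) for 1 ≤ i ≤ n(d); J_{n(d)+j} = (t^j) for 1 ≤ j ≤ d+1; and J_{n(d+1)} = (t^{d+2}·s), where n(d+1) = C(d+3, 2). -/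
open MvPolynomial

/-- `R = ℂ[t, s]`, with `t = X 0` and `s = X 1`. -/
abbrev Rts := MvPolynomial (Fin 2) ℂ

noncomputable def tvar : Rts := X 0
noncomputable def svar : Rts := X 1

/-- The structure map `θ(F₀,F₁,F₂) = 2z₀·F₀ + 2t·z₁·F₁ + 2ts·z₂·F₂` for the local
normal form `G = z₀² + t·z₁² + t·s·z₂²` of a conic, on polynomials in `z₀,z₁,z₂`
over `R = ℂ[t,s]`. -/
noncomputable def thetaR (F : Fin 3 → MvPolynomial (Fin 3) Rts) : MvPolynomial (Fin 3) Rts :=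
  2 * X 0 * F 0 + 2 * C tvar * X 1 * F 1 + 2 * C tvar * C svar * X 2 * F 2

/-- The matrix of `θ` in degree `d`, with columns indexed by the monomial basis
`M_d × {0,1,2}` of the source and rows indexed by the monomial basis `M_{d+1}` of the
target: the entry at row `β`, column `(α, i)` is the `R`-coefficient of the monomial
`z^β` in `θ` applied to the basis element placing `z^α` in slot `i`. -/
noncomputable def thetaMatrix (d : ℕ) :
    Matrix ↥(Finset.Nat.antidiagonalTuple 3 (d + 1))
      (↥(Finset.Nat.antidiagonalTuple 3 d) × Fin 3) Rts :=
  fun β c =>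
    coeff (Finsupp.equivFunOnFinite.symm (β : Fin 3 → ℕ))
      (thetaR (Pi.single c.2 (monomial (Finsupp.equivFunOnFinite.symm (c.1 : Fin 3 → ℕ)) 1)))

/-- The ideal `J_i` of `i × i` minors of the matrix of `θ`. -/
noncomputable def minorIdeal (d i : ℕ) : Ideal Rts :=
  Ideal.span {x | ∃ (r : Fin i → ↥(Finset.Nat.antidiagonalTuple 3 (d + 1)))
      (c : Fin i → ↥(Finset.Nat.antidiagonalTuple 3 d) × Fin 3),
      Function.Injective r ∧ Function.Injective c ∧
      x = ((thetaMatrix d).submatrix r c).det}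

abbrev TRow (d : ℕ) := ↥(Finset.Nat.antidiagonalTuple 3 d)

noncomputable def vv : Fin 3 → Rts := ![1, tvar, tvar * svar]

def firstIdx (β : Fin 3 → ℕ) : Fin 3 := if 0 < β 0 then 0 else if 0 < β 1 then 1 else 2

theorem vv_dvd {i : Fin 3} {β : Fin 3 → ℕ} (h : 0 < β i) : vv (firstIdx β) ∣ vv i := by
  unfold firstIdx
  fin_cases i <;> simp at h <;> simp [h] <;> split_ifs <;> simp [vv]

theorem firstIdx_pos {d : ℕ} (β : TRow (d + 1)) : 0 < β.1 (firstIdx β.1) := by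
  have := Finset.Nat.mem_antidiagonalTuple.1 β.2
  rw [Fin.sum_univ_three] at this
  unfold firstIdx
  split_ifs <;> omega

theorem theta_entry (d : ℕ) (β : TRow (d + 1)) (c : TRow d × Fin 3) :
    thetaMatrix d β c = if c.1.1 + Pi.single c.2 1 = β.1 then 2 * vv c.2 else 0 := by
  obtain ⟨α, i⟩ := c
  have key : thetaR (Pi.single i (monomial (Finsupp.equivFunOnFinite.symm (α : Fin 3 → ℕ)) 1))
      = monomial (Finsupp.equivFunOnFinite.symm (α.1 + Pi.single i 1)) (2 * vv i) := by
    have h1 : (Finsupp.equivFunOnFinite.symm (α.1 + Pi.single i 1) : Fin 3 →₀ ℕ) =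
      Finsupp.single i 1 + Finsupp.equivFunOnFinite.symm α.1 := by
      ext j
      simp [Finsupp.single_apply, Pi.single_apply, add_comm, eq_comm]
    have h2 : (monomial (Finsupp.single i 1 + Finsupp.equivFunOnFinite.symm α.1) (2 * vv i) :
        MvPolynomial (Fin 3) Rts) =
        C (2 * vv i) * X i * monomial (Finsupp.equivFunOnFinite.symm α.1) 1 := by
      rw [X, C_mul_monomial, monomial_mul]; simp
    have h3 : (2 : MvPolynomial (Fin 3) Rts) = C 2 := (map_ofNat C 2).symm
    rw [h1, h2]
    unfold thetaR
    rw [h3]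
    fin_cases i <;> simp [vv] <;> ring
  unfold thetaMatrix
  simp only [key, coeff_monomial, EmbeddingLike.apply_eq_iff_eq]

theorem det_dvd (d n : ℕ) (r : Fin n → TRow (d + 1)) (c : Fin n → TRow d × Fin 3) :
    (∏ k, vv (firstIdx (r k).1)) ∣ ((thetaMatrix d).submatrix r c).det := by
  have h : ∀ i j, vv (firstIdx (r i).1) ∣ thetaMatrix d (r i) (c j) := by
    intro i j
    rw [theta_entry]
    split_ifs with h
    · apply Dvd.dvd.mul_left
      apply vv_dvd
      rw [← h]; simp
    · simp
  choose B hB using h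
  have : (thetaMatrix d).submatrix r c =
      Matrix.of fun i j => vv (firstIdx (r i).1) * (Matrix.of B) i j := by
    ext1 i j; simp [hB]
  rw [this, Matrix.det_mul_column]
  exact dvd_mul_right _ _

theorem tsub_add_single {i : Fin 3} {β : Fin 3 → ℕ} (h : 0 < β i) :
    (β - Pi.single i 1) + Pi.single i 1 = β := by
  ext j
  by_cases hj : j = i
  · subst hj; simp; omega
  · simp [Pi.single_apply, hj]

def colOf {d : ℕ} (β : TRow (d + 1)) : TRow d × Fin 3 :=
  (⟨β.1 - Pi.single (firstIdx β.1) 1, by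
    have h := Finset.Nat.mem_antidiagonalTuple.1 β.2
    rw [Finset.Nat.mem_antidiagonalTuple]
    rw [← tsub_add_single (firstIdx_pos β)] at h
    simp only [Pi.add_apply, Finset.sum_add_distrib, Finset.sum_pi_single', Finset.sum_pi_single,
      Finset.mem_univ, if_true] at h
    simp at h ⊢
    exact h⟩, firstIdx β.1)

theorem colOf_add {d : ℕ} (β : TRow (d + 1)) :
    (colOf β).1.1 + Pi.single (colOf β).2 1 = β.1 := tsub_add_single (firstIdx_pos β)

theorem wprod_mem (d n : ℕ) (r : Fin n → TRow (d + 1)) (hr : Function.Injective r) :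
    (∏ k, vv (firstIdx (r k).1)) ∈ minorIdeal d n := by
  have h : ((thetaMatrix d).submatrix r (colOf ∘ r)).det ∈ minorIdeal d n := by
    apply Ideal.subset_span
    refine ⟨r, colOf ∘ r, hr, ?_, rfl⟩
    intro a b hab
    apply hr
    apply Subtype.ext
    rw [← colOf_add (r a), ← colOf_add (r b)]
    simp only [Function.comp] at hab
    rw [hab]
  have h2 : (thetaMatrix d).submatrix r (colOf ∘ r) =
      Matrix.diagonal fun k => 2 * vv (firstIdx (r k).1) := by
    ext1 a b
    rw [Matrix.submatrix_apply, theta_entry, Matrix.diagonal_apply, Function.comp, colOf_add]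
    by_cases hab : a = b
    · subst hab; simp [colOf]
    · rw [if_neg, if_neg hab]
      intro h; exact hab (hr (Subtype.ext h)).symm
  rw [h2, Matrix.det_diagonal, Finset.prod_mul_distrib, Finset.prod_const] at h
  have h3 := Ideal.mul_mem_left _ (C ((1/2 : ℂ)) ^ (Finset.univ : Finset (Fin n)).card) h
  have h4 : (C (1/2 : ℂ) : Rts) * 2 = 1 := by
    have : (2 : Rts) = C 2 := (map_ofNat C 2).symm
    rw [this, ← C_mul]; norm_num
  rwa [← mul_assoc, ← mul_pow, h4, one_pow, one_mul] at h3

noncomputable def wS {d : ℕ} (S : Finset (TRow (d + 1))) : Rts := ∏ β ∈ S, vv (firstIdx β.1)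

theorem minorIdeal_eq (d n : ℕ) (g : Rts) (h1 : ∀ S : Finset (TRow (d + 1)), S.card = n → g ∣ wS S)
    (h2 : ∃ S : Finset (TRow (d + 1)), S.card = n ∧ wS S = g) :
    minorIdeal d n = Ideal.span {g} := by
  apply le_antisymm
  · unfold minorIdeal
    rw [Ideal.span_le]
    rintro _ ⟨r, c, hr, hc, rfl⟩
    rw [SetLike.mem_coe, Ideal.mem_span_singleton]
    refine dvd_trans ?_ (det_dvd d n r c)
    have := h1 (Finset.univ.map ⟨r, hr⟩) (by simp)
    simpa [wS] using this
  · rw [Ideal.span_le, Set.singleton_subset_iff]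
    obtain ⟨S, hS, rfl⟩ := h2
    have := wprod_mem d n (fun k => (S.equivFinOfCardEq hS).symm k)
      (Subtype.val_injective.comp (Equiv.injective _))
    rw [(Equiv.prod_comp (S.equivFinOfCardEq hS).symm (fun x => vv (firstIdx x.1.1)))] at this
    rwa [Finset.prod_coe_sort S (fun x => vv (firstIdx x.1))] at this

def Pset (d : ℕ) : Finset (TRow (d + 1)) := Finset.univ.filter fun β => 0 < β.1 0

def lastRow (d : ℕ) : TRow (d + 1) := ⟨![0, 0, d + 1], by
  rw [Finset.Nat.mem_antidiagonalTuple]; simp [Fin.sum_univ_three]⟩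

theorem card_TRow (d : ℕ) : Fintype.card (TRow d) = (d + 2).choose 2 := by
  rw [Fintype.card_coe]
  have : (Finset.Nat.antidiagonalTuple 3 d).card =
      (Finset.finsuppAntidiag (Finset.univ : Finset (Fin 3)) d).card := by
    refine Finset.card_bij' (fun a _ => Finsupp.equivFunOnFinite.symm a) (fun a _ => ⇑a) ?_ ?_ ?_ ?_
    · intro a ha; simpa [Finset.Nat.mem_antidiagonalTuple] using ha
    · intro a ha; simpa [Finset.Nat.mem_antidiagonalTuple] using ha
    · intro a ha; simp
    · intro a ha; ext; simp
  rw [this, Finset.card_finsuppAntidiag_nat_eq_choose]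
  simp
  rw [← Nat.choose_symm_add]; congr 1; omega

theorem card_Pset (d : ℕ) : (Pset d).card = (d + 2).choose 2 := by
  rw [← card_TRow, ← Finset.card_univ]
  symm
  apply Finset.card_bij (fun (α : TRow d) _ => (⟨α.1 + Pi.single 0 1, by
    have := Finset.Nat.mem_antidiagonalTuple.1 α.2
    rw [Finset.Nat.mem_antidiagonalTuple]
    simp only [Pi.add_apply, Finset.sum_add_distrib, this]; simp⟩ : TRow (d + 1)))
  · intro a _; simp [Pset]
  · intro a _ b _ h
    apply Subtype.ext
    simpa using h
  · intro β hβ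
    simp only [Pset, Finset.mem_filter, Finset.mem_univ, true_and] at hβ
    have hf : firstIdx β.1 = 0 := by simp [firstIdx, hβ]
    refine ⟨(colOf β).1, Finset.mem_univ _, Subtype.ext ?_⟩
    have := colOf_add β
    have h2 : (colOf β).2 = 0 := hf
    rwa [h2] at this

theorem w_P {d : ℕ} {β : TRow (d + 1)} (h : β ∈ Pset d) : vv (firstIdx β.1) = 1 := by
  simp [Pset] at h
  simp [firstIdx, h, vv]

theorem w_not_P {d : ℕ} {β : TRow (d + 1)} (h : β ∉ Pset d) : tvar ∣ vv (firstIdx β.1) := by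
  simp [Pset] at h
  simp only [firstIdx, h]
  simp; split_ifs <;> simp [vv]

theorem w_mid {d : ℕ} {β : TRow (d + 1)} (h : β ∉ Pset d) (h' : β ≠ lastRow d) :
    vv (firstIdx β.1) = tvar := by
  simp [Pset] at h
  have : 0 < β.1 1 := by
    by_contra h1
    apply h'
    apply Subtype.ext
    have := Finset.Nat.mem_antidiagonalTuple.1 β.2
    rw [Fin.sum_univ_three] at this
    ext j
    fin_cases j <;> simp [lastRow] <;> omega
  simp [firstIdx, h, this, vv]

theorem last_not_P (d : ℕ) : lastRow d ∉ Pset d := by simp [lastRow, Pset]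

theorem w_last (d : ℕ) : vv (firstIdx (lastRow d).1) = tvar * svar := by
  simp [lastRow, firstIdx, vv]

theorem choose_succ (d : ℕ) : (d + 3).choose 2 = (d + 2).choose 2 + (d + 2) := by
  rw [Nat.choose_succ_succ' (d+2) 1]; simp; omega

theorem wS_dvd {d j : ℕ} (S : Finset (TRow (d + 1))) (h : S.card = (d + 2).choose 2 + j) :
    tvar ^ j ∣ wS S := by
  have hc : j ≤ (S \ Pset d).card := by
    have := Finset.le_card_sdiff (Pset d) S
    rw [card_Pset, h] at this; omega
  have h1 : tvar ^ (S \ Pset d).card ∣ wS (S \ Pset d) := by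
    rw [← Finset.prod_const]
    exact Finset.prod_dvd_prod_of_dvd _ _ fun β hβ => w_not_P (Finset.mem_sdiff.1 hβ).2
  have h2 : wS (S \ Pset d) ∣ wS S :=
    Finset.prod_dvd_prod_of_subset _ _ _ Finset.sdiff_subset
  exact ((pow_dvd_pow _ hc).trans h1).trans h2

def Mid (d : ℕ) : Finset (TRow (d + 1)) := (Finset.univ \ Pset d).erase (lastRow d)

theorem card_Mid (d : ℕ) : (Mid d).card = d + 1 := by
  unfold Mid
  rw [Finset.card_erase_of_mem (by simp [last_not_P]), Finset.card_sdiff_of_subset (Finset.subset_univ _),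
    card_Pset, Finset.card_univ, card_TRow, choose_succ]
  omega

theorem wS_union {d : ℕ} (T : Finset (TRow (d + 1))) (hT : T ⊆ Mid d) :
    wS (Pset d ∪ T) = tvar ^ T.card ∧ (Pset d ∪ T).card = (d + 2).choose 2 + T.card := by
  have hd : Disjoint (Pset d) T := by
    rw [Finset.disjoint_right]
    intro a ha
    have := hT ha
    simp [Mid] at this
    exact this.2
  refine ⟨?_, by rw [Finset.card_union_of_disjoint hd, card_Pset]⟩
  unfold wS
  rw [Finset.prod_union hd, Finset.prod_congr rfl (fun β hβ => w_P hβ), Finset.prod_const_one,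
    one_mul, ← Finset.prod_const]
  apply Finset.prod_congr rfl
  intro β hβ
  have := hT hβ
  simp [Mid] at this
  exact w_mid this.2 this.1

theorem wS_univ (d : ℕ) : wS (Finset.univ : Finset (TRow (d + 1))) = tvar ^ (d + 2) * svar := by
  have h := (wS_union (Mid d) subset_rfl).1
  have hl : lastRow d ∉ Pset d ∪ Mid d := by simp [Mid, last_not_P]
  have hu : (Finset.univ : Finset (TRow (d + 1))) = insert (lastRow d) (Pset d ∪ Mid d) := by
    ext β; simp [Mid]; tauto
  rw [hu]
  unfold wS at h ⊢
  rw [Finset.prod_insert hl, h, w_last, card_Mid]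
  ring

/-- **Key determinantal computation in the proof of Theorem 3.2.**  Writing
`n(d) = C(d+2,2)`, the minor ideals of the matrix of `θ` are:
`J_i = (1)` for `1 ≤ i ≤ n(d)`; `J_{n(d)+j} = (t^j)` for `1 ≤ j ≤ d+1`; and
`J_{n(d+1)} = (t^{d+2}·s)`, where `n(d+1) = C(d+3,2)`. -/
theorem minorIdeals_of_thetaMatrix (d : ℕ) :
    (∀ i : ℕ, 1 ≤ i → i ≤ (d + 2).choose 2 → minorIdeal d i = Ideal.span {(1 : Rts)}) ∧
    (∀ j : ℕ, 1 ≤ j → j ≤ d + 1 →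
      minorIdeal d ((d + 2).choose 2 + j) = Ideal.span {tvar ^ j}) ∧
    minorIdeal d ((d + 3).choose 2) = Ideal.span {tvar ^ (d + 2) * svar} := by
  refine ⟨?_, ?_, ?_⟩
  · intro i _ hi
    apply minorIdeal_eq _ _ _ (fun _ _ => one_dvd _)
    rw [← card_Pset] at hi
    obtain ⟨S, hS, hc⟩ := Finset.exists_subset_card_eq hi
    exact ⟨S, hc, Finset.prod_eq_one fun β hβ => w_P (hS hβ)⟩
  · intro j _ hj
    apply minorIdeal_eq _ _ _ (fun S hS => wS_dvd S hS)
    rw [← card_Mid] at hj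
    obtain ⟨T, hT, rfl⟩ := Finset.exists_subset_card_eq hj
    exact ⟨_, (wS_union T hT).2, (wS_union T hT).1⟩
  · have hc : (Finset.univ : Finset (TRow (d + 1))).card = (d + 3).choose 2 := by
      rw [Finset.card_univ, card_TRow]
    apply minorIdeal_eq
    · intro S hS
      rw [Finset.card_eq_iff_eq_univ S |>.1 (by rw [hS, card_TRow]), wS_univ]
    · exact ⟨_, hc, wS_univ d⟩
end

section
/- Let d ≥ 1 be an integer, let t ∈ ℂ with t ≠ 0, and set G = z_0·z_1 + t·z_2² ∈ ℂ[z_0, z_1, z_2]. Then the ℂ-subspace {(F_0, F_1, F_2) ∈ S_d^3 : G divides z_1·F_0 + z_0·F_1 + 2t·z_2·F_2} of S_d^3 equals the set of all tuples of the form H_1·(−z_0, z_1, 0) + H_2·(−2t·z_2, 0, z_1) + H_3·(0, −2t·z_2, z_0) + H_4·(z_0, z_1, z_2) with H_1, H_2, H_3, H_4 ∈ S_{d−1}. -/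
open MvPolynomial

lemma aux_hc (n : ℕ) (p : MvPolynomial (Fin 3) ℂ) (i : Fin 3) :
    homogeneousComponent (n + 1) (p * X i) = homogeneousComponent n p * X i := by
  ext m
  rw [coeff_homogeneousComponent, coeff_mul_X', coeff_mul_X']
  by_cases hi : i ∈ m.support
  · simp only [hi, if_true]
    rw [coeff_homogeneousComponent]
    have hle : Finsupp.single i 1 ≤ m := by
      rw [Finsupp.single_le_iff]
      exact Nat.one_le_iff_ne_zero.mpr (Finsupp.mem_support_iff.mp hi)
    have h1 : m.degree = (m - Finsupp.single i 1).degree + 1 := by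
      conv_lhs => rw [← tsub_add_cancel_of_le hle]
      rw [map_add, Finsupp.degree_single]
    simp only [h1, Nat.add_right_cancel_iff]
  · simp [hi]

lemma aux_koszul (c : ℂ) (hc : c ≠ 0) (A B D : MvPolynomial (Fin 3) ℂ)
    (h : X 1 * A + X 0 * B + C c * X 2 * D = 0) :
    ∃ H₁ H₂ H₃ : MvPolynomial (Fin 3) ℂ,
      A = -(H₁ * X 0) - C c * (H₂ * X 2) ∧ B = H₁ * X 1 - C c * (H₃ * X 2) ∧
      D = H₂ * X 1 + H₃ * X 0 := by
  have hcc : (C c⁻¹ * C c : MvPolynomial (Fin 3) ℂ) = 1 := by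
    rw [← C_mul, inv_mul_cancel₀ hc, C_1]
  have hX : X 2 * D ∈ Ideal.span ((X : Fin 3 → MvPolynomial (Fin 3) ℂ) '' {1, 0}) := by
    rw [Set.image_pair, Ideal.mem_span_pair]
    exact ⟨-(C c⁻¹ * A), -(C c⁻¹ * B), by linear_combination (-C c⁻¹) * h + X 2 * D * hcc⟩
  have hD : D ∈ Ideal.span ((X : Fin 3 → MvPolynomial (Fin 3) ℂ) '' {1, 0}) := by
    rw [mem_ideal_span_X_image] at hX ⊢
    intro m hm
    obtain ⟨i, hi, hne⟩ := hX (Finsupp.single 2 1 + m) (by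
      rw [support_X_mul]
      exact Finset.mem_map_of_mem _ hm)
    refine ⟨i, hi, ?_⟩
    rcases hi with rfl | rfl <;> simpa using hne
  rw [Set.image_pair, Ideal.mem_span_pair] at hD
  obtain ⟨H₂, H₃, hD⟩ := hD
  have hdvd : (X 1 : MvPolynomial (Fin 3) ℂ) ∣ X 0 * (B + C c * X 2 * H₃) :=
    ⟨-(A + C c * X 2 * H₂), by linear_combination h + C c * X 2 * hD⟩
  have hp : Prime (X 1 : MvPolynomial (Fin 3) ℂ) := X_prime
  rcases hp.dvd_or_dvd hdvd with h0 | ⟨H₁, h1⟩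
  · rw [X_dvd_X] at h0
    simp at h0
  · refine ⟨H₁, H₂, H₃, ?_, ?_, hD.symm⟩
    · apply mul_left_cancel₀ hp.ne_zero
      linear_combination h + C c * X 2 * hD - X 0 * h1
    · linear_combination h1

/-- **Fiber computation in the proof of Theorem 3.6.**  For `d ≥ 1`, `t ≠ 0` and the
smooth conic `G = z₀z₁ + t·z₂²`, the space of triples `(F₀,F₁,F₂)` of homogeneous
degree-`d` polynomials with `G ∣ z₁F₀ + z₀F₁ + 2t·z₂F₂` (i.e. the vector fields
`X = F₀∂₀ + F₁∂₁ + F₂∂₂` leaving `{G = 0}` invariant, since `∂G/∂z₀ = z₁`,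
`∂G/∂z₁ = z₀`, `∂G/∂z₂ = 2tz₂`) is exactly the set of combinations
`H₁·(−z₀, z₁, 0) + H₂·(−2tz₂, 0, z₁) + H₃·(0, −2tz₂, z₀) + H₄·(z₀, z₁, z₂)`
with `H₁,…,H₄` homogeneous of degree `d−1`. -/
theorem fields_leaving_conic_invariant_eq_span (d : ℕ) (hd : 1 ≤ d) (t : ℂ) (ht : t ≠ 0)
    (G : MvPolynomial (Fin 3) ℂ) (hG : G = X 0 * X 1 + C t * X 2 ^ 2) :
    {F : Fin 3 → MvPolynomial (Fin 3) ℂ |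
        (∀ i, F i ∈ homogeneousSubmodule (Fin 3) ℂ d) ∧
        G ∣ (X 1 * F 0 + X 0 * F 1 + C (2 * t) * X 2 * F 2)}
      = {F : Fin 3 → MvPolynomial (Fin 3) ℂ |
          ∃ H₁ ∈ homogeneousSubmodule (Fin 3) ℂ (d - 1),
          ∃ H₂ ∈ homogeneousSubmodule (Fin 3) ℂ (d - 1),
          ∃ H₃ ∈ homogeneousSubmodule (Fin 3) ℂ (d - 1),
          ∃ H₄ ∈ homogeneousSubmodule (Fin 3) ℂ (d - 1),
          F = fun j => H₁ * ![-(X 0), X 1, 0] j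
            + H₂ * ![-(C (2 * t) * X 2), 0, X 1] j
            + H₃ * ![0, -(C (2 * t) * X 2), X 0] j
            + H₄ * ![X 0, X 1, X 2] j} := by
  subst hG
  obtain ⟨n, rfl⟩ : ∃ n, d = n + 1 := ⟨d - 1, by omega⟩
  ext F
  simp only [Set.mem_ofPred_eq, Nat.add_sub_cancel]
  constructor
  · rintro ⟨hF, Q, hQ⟩
    have h2 : (C 2 * C (1 / 2) : MvPolynomial (Fin 3) ℂ) = 1 := by
      rw [← C_mul]; norm_num
    have h2' : (C 2 : MvPolynomial (Fin 3) ℂ) = 2 := rfl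
    obtain ⟨H₁, H₂, H₃, e0, e1, e2⟩ := aux_koszul (2 * t) (by simpa using ht)
      (F 0 - C (1 / 2) * Q * X 0) (F 1 - C (1 / 2) * Q * X 1) (F 2 - C (1 / 2) * Q * X 2) (by
        rw [C_mul] at hQ ⊢
        rw [h2'] at hQ h2 ⊢
        linear_combination hQ - (X 0 * X 1 + C t * X 2 ^ 2) * Q * h2)
    have key : ∀ i, homogeneousComponent (n + 1) (F i) = F i := fun i => by
      rw [homogeneousComponent_of_mem (hF i), if_pos rfl]
    rw [sub_eq_iff_eq_add] at e0 e1 e2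
    have f0 := congrArg (homogeneousComponent (n + 1)) e0
    have f1 := congrArg (homogeneousComponent (n + 1)) e1
    have f2 := congrArg (homogeneousComponent (n + 1)) e2
    simp only [key, map_add, map_sub, map_neg, homogeneousComponent_C_mul, aux_hc] at f0 f1 f2
    refine ⟨homogeneousComponent n H₁, homogeneousComponent_mem _ _,
      homogeneousComponent n H₂, homogeneousComponent_mem _ _,
      homogeneousComponent n H₃, homogeneousComponent_mem _ _,
      homogeneousComponent n (C (1 / 2) * Q), homogeneousComponent_mem _ _, ?_⟩
    funext j
    fin_cases j
    · simp [-one_div, -map_mul, -C_mul, homogeneousComponent_C_mul] at f0 ⊢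
      linear_combination f0
    · simp [-one_div, -map_mul, -C_mul, homogeneousComponent_C_mul] at f1 ⊢
      linear_combination f1
    · simp [-one_div, -map_mul, -C_mul, homogeneousComponent_C_mul] at f2 ⊢
      linear_combination f2
  · rintro ⟨H₁, h1, H₂, h2, H₃, h3, H₄, h4, rfl⟩
    constructor
    · have hm : ∀ (H : MvPolynomial (Fin 3) ℂ), H ∈ homogeneousSubmodule (Fin 3) ℂ n →
          ∀ L ∈ homogeneousSubmodule (Fin 3) ℂ 1,
          H * L ∈ homogeneousSubmodule (Fin 3) ℂ (n + 1) := fun H hH L hL =>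
        IsHomogeneous.mul hH hL
      have x1 : ∀ i : Fin 3, (X i : MvPolynomial (Fin 3) ℂ) ∈ homogeneousSubmodule (Fin 3) ℂ 1 :=
        fun i => isHomogeneous_X ℂ i
      have c1 : ∀ i : Fin 3, (C (2 * t) * X i : MvPolynomial (Fin 3) ℂ) ∈
          homogeneousSubmodule (Fin 3) ℂ 1 := fun i => by
        rw [← smul_eq_C_mul]; exact Submodule.smul_mem _ _ (x1 i)
      intro j
      refine add_mem (add_mem (add_mem (hm _ h1 _ ?_) (hm _ h2 _ ?_)) (hm _ h3 _ ?_))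
        (hm _ h4 _ ?_) <;> fin_cases j
      all_goals first
        | exact x1 _
        | exact neg_mem (x1 _)
        | exact neg_mem (c1 _)
        | exact zero_mem _
    · have h2' : (C 2 : MvPolynomial (Fin 3) ℂ) = 2 := rfl
      refine ⟨2 * H₄, ?_⟩
      simp only [Matrix.cons_val_zero, Matrix.cons_val_one, Matrix.cons_val, C_mul, h2']
      ring
end
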